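/- Let Ω, Ω′ > 0 and x, x′ ∈ (0, 1], and define p_{11}(t; Ω, x) = (x²/2) cos(2Ωt) + 2x(1−x) cos(Ωt) + (1−x)² + x²/2. If p_{11}(t; Ω, x) = p_{11}(t; Ω′, x′) for all t ∈ ℝ, then Ω = Ω′ and x = x′. Hence the single measurement trace p_{11} uniquely identifies the parameters (Ω, x) of the effective Hamiltonian. -/

import Mathlib

theorem hasDerivAt_cos_add_cos (a b c u v t : ℝ) :
    HasDerivAt (fun t => a * Real.cos (u * t) + b * Real.cos (v * t) + c)
      (-(a * u * Real.sin (u * t) + b * v * Real.sin (v * t))) t := by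
  have hcos (w : ℝ) : HasDerivAt (fun t => Real.cos (w * t)) (-Real.sin (w * t) * (w * 1)) t :=
    ((hasDerivAt_id t).const_mul w).cos
  exact ((((hcos u).const_mul a).add ((hcos v).const_mul b)).add_const c).congr_deriv (by ring)

theorem hasDerivAt_sin_add_sin (a b u v t : ℝ) :
    HasDerivAt (fun t => -(a * u * Real.sin (u * t) + b * v * Real.sin (v * t)))
      (-(a * u ^ 2 * Real.cos (u * t) + b * v ^ 2 * Real.cos (v * t))) t := by
  have hsin (w : ℝ) : HasDerivAt (fun t => Real.sin (w * t)) (Real.cos (w * t) * (w * 1)) t :=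
    ((hasDerivAt_id t).const_mul w).sin
  exact (((hsin u).const_mul (a * u)).add ((hsin v).const_mul (b * v))).neg.congr_deriv (by ring)

/-- If two sums of two cosines and a constant agree, so do their second derivatives. -/
theorem cos_add_cos_second_deriv_eq {a b c u v a' b' c' u' v' : ℝ}
    (h : ∀ t : ℝ, a * Real.cos (u * t) + b * Real.cos (v * t) + c =
      a' * Real.cos (u' * t) + b' * Real.cos (v' * t) + c') (t : ℝ) :
    a * u ^ 2 * Real.cos (u * t) + b * v ^ 2 * Real.cos (v * t) =
      a' * u' ^ 2 * Real.cos (u' * t) + b' * v' ^ 2 * Real.cos (v' * t) := by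
  have hd (s : ℝ) := (hasDerivAt_cos_add_cos a b c u v s).unique
    (funext h ▸ hasDerivAt_cos_add_cos a' b' c' u' v' s)
  exact neg_injective ((hasDerivAt_sin_add_sin a b u v t).unique
    (funext hd ▸ hasDerivAt_sin_add_sin a' b' u' v' t))

/-- **The trace `p_{11}` uniquely identifies the parameters.**
For `Ω, Ω′ > 0` and `x, x′ ∈ (0,1]`, if the signals
`p_{11}(t; Ω, x) = (x²/2)cos(2Ωt) + 2x(1−x)cos(Ωt) + (1−x)² + x²/2` agree for all
`t ∈ ℝ`, then `Ω = Ω′` and `x = x′`. -/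
theorem p11_uniquely_identifies_parameters
    (Ω Ω' x x' : ℝ) (hΩ : 0 < Ω) (hΩ' : 0 < Ω')
    (hx : x ∈ Set.Ioc (0 : ℝ) 1) (hx' : x' ∈ Set.Ioc (0 : ℝ) 1)
    (h : ∀ t : ℝ,
      x ^ 2 / 2 * Real.cos (2 * Ω * t) + 2 * x * (1 - x) * Real.cos (Ω * t)
          + (1 - x) ^ 2 + x ^ 2 / 2 =
        x' ^ 2 / 2 * Real.cos (2 * Ω' * t) + 2 * x' * (1 - x') * Real.cos (Ω' * t)
          + (1 - x') ^ 2 + x' ^ 2 / 2) :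
    Ω = Ω' ∧ x = x' := by
  have h₂ := cos_add_cos_second_deriv_eq
    (c := (1 - x) ^ 2 + x ^ 2 / 2) (c' := (1 - x') ^ 2 + x' ^ 2 / 2)
    (fun t => by simpa only [add_assoc] using h t)
  have h₄ := cos_add_cos_second_deriv_eq (c := 0) (c' := 0)
    (fun t => by simpa only [add_zero] using h₂ t) 0
  have h₂ := h₂ 0
  simp only [mul_zero, Real.cos_zero, mul_one] at h₂ h₄
  have hA : x * Ω ^ 2 = x' * Ω' ^ 2 := by linarith
  have hpos : x * Ω ^ 2 ≠ 0 := (mul_pos hx.1 (pow_pos hΩ 2)).ne'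
  have hsq : Ω ^ 2 = Ω' ^ 2 := by
    apply mul_left_cancel₀ hpos
    linear_combination h₄ / 2 - (3 * (x * Ω ^ 2 + x' * Ω' ^ 2) + Ω' ^ 2) * hA
  have hΩΩ' : Ω = Ω' := (pow_left_inj₀ hΩ.le hΩ'.le two_ne_zero).mp hsq
  subst hΩΩ'
  exact ⟨rfl, mul_right_cancel₀ (pow_pos hΩ 2).ne' hA⟩
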